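/- Let p be a prime and n, k, r natural numbers with k ≤ n < p and r ≥ 1, and suppose that, as real numbers, k < n + p − √(n² + p² − 4p + 2). Then 2nk − k² − 1 ≤ 2p(n − k + r) + 2p − 4 (as integers). -/

import Mathlib

/-- Let `p` be a prime, `n, k, r` naturals with `k ≤ n < p`, `r ≥ 1`, and suppose that
as real numbers `k < n + p − √(n² + p² − 4p + 2)`.  Then, as integers,
`2nk − k² − 1 ≤ 2p(n − k + r) + 2p − 4`. -/
theorem stmt_5 (p n k r : ℕ) (hp : p.Prime) (hkn : k ≤ n) (hnp : n < p) (hr : 1 ≤ r)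
    (hk : (k : ℝ) < (n : ℝ) + (p : ℝ) -
      Real.sqrt ((n : ℝ) ^ 2 + (p : ℝ) ^ 2 - 4 * (p : ℝ) + 2)) :
    2 * (n : ℤ) * (k : ℤ) - (k : ℤ) ^ 2 - 1 ≤
      2 * (p : ℤ) * ((n : ℤ) - (k : ℤ) + (r : ℤ)) + 2 * (p : ℤ) - 4 := by
  have hp0 : (0 : ℝ) < p := by exact_mod_cast hp.pos
  have hkn' : (k : ℝ) ≤ n := by exact_mod_cast hkn
  have hsq : (n : ℝ) ^ 2 + (p : ℝ) ^ 2 - 4 * (p : ℝ) + 2 < ((n : ℝ) + p - k) ^ 2 :=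
    (Real.sqrt_lt' (by linarith)).1 (by linarith)
  have hint : (n : ℤ) ^ 2 + (p : ℤ) ^ 2 - 4 * (p : ℤ) + 2 < ((n : ℤ) + p - k) ^ 2 := by
    exact_mod_cast hsq
  have hpr : (p : ℤ) * 1 ≤ p * r := by gcongr; exact_mod_cast hr
  linarith
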